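/- arXiv:1401.2422 — 2 statements merged into one kernel-verified Lean document; each statement's English description precedes it below -/
import Mathlib

section
/- Let C be an [n,k] linear code over a field F with all-symbol locality r, i.e., for every coordinate i ∈ {1,…,n} there is a codeword of C^⊥ of Hamming weight at most r+1 whose support contains i. Let B0 be the subspace of C^⊥ spanned by all codewords of C^⊥ of Hamming weight at most r+1, and set b = ⌈n/(r+1)⌉. Define the sequence e_1,…,e_b recursively by e_b = n and e_{m−1} = e_m − ⌈2 e_m / m⌉ + (r+1) for 2 ≤ m ≤ b. Then: (i) d_m(B0) ≤ e_m for 1 ≤ m ≤ b; and (ii) if ℓ is an integer with 1 ≤ ℓ ≤ b−1 satisfying e_ℓ < k+ℓ < e_{ℓ+1}, then the minimum distance of C satisfies d_min(C) ≤ n + 1 − (k + ℓ). -/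
open Classical in
/-- The support of a vector: the set of coordinates where it is nonzero. -/
noncomputable def vsupp {F : Type*} [Field F] {n : ℕ} (v : Fin n → F) : Finset (Fin n) :=
  Finset.univ.filter (fun i => v i ≠ 0)

open Classical in
/-- The support of a subspace: the union of the supports of its vectors. -/
noncomputable def codeSupp {F : Type*} [Field F] {n : ℕ}
    (D : Submodule F (Fin n → F)) : Finset (Fin n) :=
  Finset.univ.filter (fun i => ∃ v ∈ D, v i ≠ 0)

/-- The dual code w.r.t. the standard bilinear form `⟨x,y⟩ = ∑ x i * y i`. -/
def dualCode {F : Type*} [Field F] {n : ℕ} (C : Submodule F (Fin n → F)) :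
    Submodule F (Fin n → F) where
  carrier := {w | ∀ v ∈ C, ∑ i, v i * w i = 0}
  zero_mem' := by intro v _; simp
  add_mem' := by
    intro a b ha hb v hv
    have h : ∑ i, v i * (a + b) i = (∑ i, v i * a i) + ∑ i, v i * b i := by
      simp [mul_add, Finset.sum_add_distrib]
    rw [h, ha v hv, hb v hv, add_zero]
  smul_mem' := by
    intro c a ha v hv
    have h : ∑ i, v i * (c • a) i = c * ∑ i, v i * a i := by
      simp [Finset.mul_sum, mul_left_comm]
    rw [h, ha v hv, mul_zero]

/-- The `i`-th generalized Hamming weight (1-indexed): the minimum support cardinality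
of an `i`-dimensional subspace. -/
noncomputable def ghw {F : Type*} [Field F] {n : ℕ} (C : Submodule F (Fin n → F)) (i : ℕ) : ℕ :=
  sInf {s | ∃ D : Submodule F (Fin n → F), D ≤ C ∧ Module.finrank F D = i ∧ (codeSupp D).card = s}

/-- The set of gaps of a code: elements of `{1,…,n}` that are not generalized Hamming weights. -/
noncomputable def gapSet {F : Type*} [Field F] {n : ℕ} (C : Submodule F (Fin n → F)) : Finset ℕ :=
  (Finset.Icc 1 n) \ ((Finset.Icc 1 (Module.finrank F C)).image (ghw C))

/-- The `i`-th gap of a code (1-indexed), via the increasing enumeration of the gap set. -/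
noncomputable def gapNum {F : Type*} [Field F] {n : ℕ} (C : Submodule F (Fin n → F)) (i : ℕ) : ℕ :=
  ((gapSet C).sort (· ≤ ·)).getD (i - 1) 0

/-- The minimum distance of a code: the minimum Hamming weight of a nonzero codeword. -/
noncomputable def dmin {F : Type*} [Field F] {n : ℕ} (C : Submodule F (Fin n → F)) : ℕ :=
  sInf {w | ∃ v ∈ C, v ≠ 0 ∧ (vsupp v).card = w}

/-- `S` is an `ℓ`-core (`ℓ = S.card`) of `B` if no nonzero codeword of `B`
has its support contained in `S`. -/
def isCore {F : Type*} [Field F] {n : ℕ} (B : Submodule F (Fin n → F)) (S : Finset (Fin n)) : Prop :=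
  ∀ v ∈ B, v ≠ 0 → ¬ (vsupp v ⊆ S)

/-- The subspace of the dual code spanned by all its codewords of Hamming weight `≤ r+1`. -/
noncomputable def lowWtSpan {F : Type*} [Field F] {n : ℕ}
    (C : Submodule F (Fin n → F)) (r : ℕ) : Submodule F (Fin n → F) :=
  Submodule.span F {c | c ∈ dualCode C ∧ (vsupp c).card ≤ r + 1}

/-- `A_i`: the set of local parities covering coordinate `i`, i.e. dual codewords of
Hamming weight at most `r+1` whose support contains `i`. -/
def coveringParities {F : Type*} [Field F] {n : ℕ}
    (C : Submodule F (Fin n → F)) (r : ℕ) (i : Fin n) : Set (Fin n → F) :=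
  {c | c ∈ dualCode C ∧ (vsupp c).card ≤ r + 1 ∧ c i ≠ 0}

/-- `C` is locally 2-reconstructible with locality `r`: every `A_i` is nonempty
and `A_i ≠ A_j` for `i ≠ j`. -/
def Locally2Recon {F : Type*} [Field F] {n : ℕ}
    (C : Submodule F (Fin n → F)) (r : ℕ) : Prop :=
  (∀ i : Fin n, (coveringParities C r i).Nonempty) ∧
  (∀ i j : Fin n, i ≠ j → coveringParities C r i ≠ coveringParities C r j)

/-- If every member of a family of `m` finite sets has at most `q` elements, then some member has at
least `2 s / m - q` elements lying in no other member, where `s` is the size of the union. -/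
lemma exists_two_mul_card_biUnion_le {α β : Type*} [DecidableEq α] [DecidableEq β]
    {T : Finset α} (hT : T.Nonempty) (f : α → Finset β) {q : ℕ} (hf : ∀ t ∈ T, (f t).card ≤ q) :
    ∃ t ∈ T, 2 * (T.biUnion f).card ≤
      T.card * (q + (T.biUnion f \ (T.erase t).biUnion f).card) := by
  have key : 2 * (T.biUnion f).card ≤
      ∑ t ∈ T, ((f t).card + (T.biUnion f \ (T.erase t).biUnion f).card) := by
    have h₁ : ∑ t ∈ T, (f t).card = ∑ x ∈ T.biUnion f, (T.filter (fun t => x ∈ f t)).card := by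
      refine Eq.trans ?_
        (Finset.sum_card_bipartiteAbove_eq_sum_card_bipartiteBelow (fun t x => x ∈ f t))
      refine Finset.sum_congr rfl fun t ht => congrArg Finset.card ?_
      ext x
      simp only [Finset.bipartiteAbove, Finset.mem_filter, Finset.mem_biUnion]
      exact ⟨fun hx => ⟨⟨t, ht, hx⟩, hx⟩, fun hx => hx.2⟩
    have h₂ : ∑ t ∈ T, (T.biUnion f \ (T.erase t).biUnion f).card =
        ∑ x ∈ T.biUnion f, (T.filter (fun t => x ∉ (T.erase t).biUnion f)).card := by
      refine Eq.trans ?_ (Finset.sum_card_bipartiteAbove_eq_sum_card_bipartiteBelow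
        (fun t x => x ∉ (T.erase t).biUnion f))
      refine Finset.sum_congr rfl fun t _ => congrArg Finset.card ?_
      ext x
      simp only [Finset.bipartiteAbove, Finset.mem_filter, Finset.mem_sdiff]
    rw [Finset.sum_add_distrib, h₁, h₂, ← Finset.sum_add_distrib, mul_comm, ← smul_eq_mul]
    refine Finset.card_nsmul_le_sum _ _ _ fun x hx => ?_
    obtain ⟨t, ht, hxt⟩ := Finset.mem_biUnion.1 hx
    by_cases hu : ∃ u ∈ T, u ≠ t ∧ x ∈ f u
    · obtain ⟨u, hu, hut, hxu⟩ := hu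
      have : 1 < (T.filter (fun t => x ∈ f t)).card :=
        Finset.one_lt_card.2 ⟨u, by simp [hu, hxu], t, by simp [ht, hxt], hut⟩
      omega
    · have hA : 0 < (T.filter (fun t => x ∈ f t)).card :=
        Finset.card_pos.2 ⟨t, by simp [ht, hxt]⟩
      have hB : 0 < (T.filter (fun t => x ∉ (T.erase t).biUnion f)).card := by
        refine Finset.card_pos.2 ⟨t, Finset.mem_filter.2 ⟨ht, fun hx' => hu ?_⟩⟩
        obtain ⟨u, hu', hxu⟩ := Finset.mem_biUnion.1 hx'
        exact ⟨u, Finset.mem_of_mem_erase hu', Finset.ne_of_mem_erase hu', hxu⟩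
      omega
  by_contra! hcon
  have hlt : ∑ t ∈ T, T.card * (q + (T.biUnion f \ (T.erase t).biUnion f).card) <
      ∑ _t ∈ T, 2 * (T.biUnion f).card := Finset.sum_lt_sum_of_nonempty hT hcon
  rw [← Finset.mul_sum, Finset.sum_const, smul_eq_mul] at hlt
  refine absurd (lt_of_mul_lt_mul_left' hlt) (not_lt.2 (key.trans ?_))
  exact Finset.sum_le_sum fun t ht => Nat.add_le_add_right (hf t ht) _

lemma sub_ceil_two_mul_div_mono {m : ℕ} (hm : 2 ≤ m) {s t : ℤ} (hst : s ≤ t) :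
    s - ⌈2 * (s : ℚ) / m⌉ ≤ t - ⌈2 * (t : ℚ) / m⌉ := by
  have hm0 : (0 : ℚ) < m := by positivity
  have hm2 : (2 : ℚ) ≤ m := by exact_mod_cast hm
  have hst' : (s : ℚ) ≤ t := by exact_mod_cast hst
  have : ⌈2 * (t : ℚ) / m⌉ ≤ ⌈2 * (s : ℚ) / m⌉ + (t - s) := by
    rw [Int.ceil_le]
    have hs := Int.le_ceil (2 * (s : ℚ) / m)
    have h : 2 * (t : ℚ) / m ≤ 2 * (s : ℚ) / m + (t - s) := by
      rw [div_add' _ _ _ hm0.ne', div_le_div_iff_of_pos_right hm0]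
      nlinarith
    push_cast
    linarith
  linarith

section Codes

variable {F : Type*} [Field F] {n : ℕ}

lemma mem_vsupp {v : Fin n → F} {i : Fin n} : i ∈ vsupp v ↔ v i ≠ 0 := by
  simp [vsupp]

open Classical in
lemma codeSupp_span_subset (T : Finset (Fin n → F)) :
    codeSupp (Submodule.span F (T : Set (Fin n → F))) ⊆ T.biUnion vsupp := by
  intro i hi
  obtain ⟨v, hv, hvi⟩ := (Finset.mem_filter.1 hi).2
  by_contra hiT
  refine hvi ?_
  have hle : Submodule.span F (T : Set (Fin n → F)) ≤ LinearMap.ker (LinearMap.proj i) := by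
    refine Submodule.span_le.2 fun w hw => ?_
    by_contra hwi
    exact hiT (Finset.mem_biUnion.2 ⟨w, hw, mem_vsupp.2 hwi⟩)
  exact hle hv

open Classical in
/-- Codewords of weight at most `q` that cover every coordinate span a space of dimension at least
`⌈n / q⌉`, and so contain that many linearly independent words. -/
lemma exists_linearIndepOn_card_eq {s : Set (Fin n → F)} {q b : ℕ} (hq : 0 < q)
    (hs : ∀ c ∈ s, (vsupp c).card ≤ q) (hcov : ∀ i : Fin n, ∃ c ∈ s, c i ≠ 0)
    (hb : b = ⌈(n : ℚ) / q⌉₊) :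
    ∃ T : Finset (Fin n → F), (T : Set (Fin n → F)) ⊆ s ∧ T.card = b ∧
      LinearIndepOn F id (T : Set (Fin n → F)) := by
  obtain ⟨B, hBs, hspan, hli⟩ := exists_linearIndependent F s
  have hfin : B.Finite := LinearIndependent.setFinite hli
  lift B to Finset (Fin n → F) using hfin
  have hcover : (Finset.univ : Finset (Fin n)) ⊆ B.biUnion vsupp := by
    intro i _
    obtain ⟨c, hc, hci⟩ := hcov i
    refine codeSupp_span_subset B (Finset.mem_filter.2 ⟨Finset.mem_univ _, c, ?_, hci⟩)
    rw [hspan]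
    exact Submodule.subset_span hc
  have hn : n ≤ B.card * q := by
    have := (Finset.card_le_card hcover).trans
      (Finset.card_biUnion_le_card_mul B vsupp q fun c hc => hs c (hBs hc))
    simpa using this
  have hbB : b ≤ B.card := by
    rw [hb, Nat.ceil_le, div_le_iff₀ (by exact_mod_cast hq)]
    exact_mod_cast hn
  obtain ⟨T, hTB, hT⟩ := Finset.exists_subset_card_eq hbB
  exact ⟨T, (Finset.coe_subset.2 hTB).trans hBs, hT,
    LinearIndepOn.mono hli (Finset.coe_subset.2 hTB)⟩

open Classical in
/-- Deleting well-chosen words one at a time from `b` linearly independent words of weight at most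
`q` leaves families whose supports obey the recursion for `e`. -/
lemma exists_linearIndepOn_card_biUnion_le {s : Set (Fin n → F)} {q b : ℕ}
    (hs : ∀ c ∈ s, (vsupp c).card ≤ q) {T₀ : Finset (Fin n → F)}
    (hT₀ : (T₀ : Set (Fin n → F)) ⊆ s) (hcard : T₀.card = b)
    (hli : LinearIndepOn F id (T₀ : Set (Fin n → F)))
    {e : ℕ → ℤ} (heb : e b = n)
    (herec : ∀ m, 2 ≤ m → m ≤ b → e (m - 1) = e m - ⌈(2 * (e m : ℚ)) / (m : ℚ)⌉ + q)
    {m : ℕ} (hm1 : 1 ≤ m) (hmb : m ≤ b) :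
    ∃ T : Finset (Fin n → F), (T : Set (Fin n → F)) ⊆ s ∧ T.card = m ∧
      LinearIndepOn F id (T : Set (Fin n → F)) ∧ ((T.biUnion vsupp).card : ℤ) ≤ e m := by
  induction hmb using Nat.decreasingInduction with
  | self =>
    refine ⟨T₀, hT₀, hcard, hli, ?_⟩
    rw [heb]
    exact_mod_cast (Finset.card_le_univ _).trans_eq (Fintype.card_fin n)
  | of_succ j hjb ih =>
    obtain ⟨T, hTs, hTc, hTli, hTe⟩ := ih (by omega)
    have hne : T.Nonempty := Finset.card_pos.1 (by omega)
    obtain ⟨t, ht, hle⟩ := exists_two_mul_card_biUnion_le hne vsupp fun c hc => hs c (hTs hc)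
    have hsub : T.erase t ⊆ T := Finset.erase_subset _ _
    refine ⟨T.erase t, (Finset.coe_subset.2 hsub).trans hTs, ?_,
      hTli.mono (Finset.coe_subset.2 hsub), ?_⟩
    · rw [Finset.card_erase_of_mem ht, hTc, Nat.add_sub_cancel]
    · have hrec := herec (j + 1) (by omega) (by omega)
      rw [Nat.add_sub_cancel] at hrec
      have hmono := sub_ceil_two_mul_div_mono (m := j + 1) (by omega) hTe
      have hsplit := Finset.card_sdiff_add_card_eq_card
        (Finset.biUnion_subset_biUnion_of_subset_left vsupp hsub)
      rw [hTc] at hle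
      have hceil : ⌈2 * (((T.biUnion vsupp).card : ℤ) : ℚ) / ((j + 1 : ℕ) : ℚ)⌉ ≤
          ((q + (T.biUnion vsupp \ (T.erase t).biUnion vsupp).card : ℕ) : ℤ) := by
        rw [Int.ceil_le, div_le_iff₀ (by positivity), mul_comm (Int.cast _ : ℚ)]
        exact_mod_cast hle
      push_cast at hceil hmono hrec ⊢
      omega

open Classical in
/-- If `ℓ` linearly independent words of the dual of a `k`-dimensional code have joint support of
size less than `k + ℓ`, then the code has a nonzero word vanishing on `k + ℓ - 1` coordinates. -/
lemma dmin_le_of_linearIndepOn_dualCode {C : Submodule F (Fin n → F)}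
    {T : Finset (Fin n → F)} (hT : (T : Set (Fin n → F)) ⊆ dualCode C)
    (hli : LinearIndepOn F id (T : Set (Fin n → F)))
    (hsupp : (T.biUnion vsupp).card < Module.finrank F C + T.card) :
    dmin C ≤ n + 1 - (Module.finrank F C + T.card) := by
  let M : Matrix T (Fin n) F := Matrix.of fun t => t.1
  have hrank : M.rank = T.card := by
    simpa using LinearIndependent.rank_matrix (M := M) hli
  have hker := M.mulVecLin.finrank_range_add_finrank_ker
  change M.rank + _ = _ at hker
  rw [hrank, Module.finrank_fin_fun] at hker
  have hCker : C ≤ LinearMap.ker M.mulVecLin := by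
    intro v hv
    ext t
    simpa [M, Matrix.mulVec, dotProduct, mul_comm] using hT t.2 v hv
  have hCle := Submodule.finrank_mono hCker
  obtain ⟨S, hTS, -, hS⟩ := Finset.exists_subsuperset_card_eq (Finset.subset_univ (T.biUnion vsupp))
    (n := Module.finrank F C + T.card - 1) (by omega) (by simp; omega)
  let R : (Fin n → F) →ₗ[F] (S → F) := LinearMap.funLeft F F Subtype.val
  have hW := R.finrank_range_add_finrank_ker
  have hR := (LinearMap.range R).finrank_le
  rw [Module.finrank_fintype_fun_eq_card, Fintype.card_coe, hS] at hR
  rw [Module.finrank_fin_fun] at hW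
  have hWzero : ∀ w ∈ LinearMap.ker R, ∀ i ∈ S, w i = 0 := fun w hw i hi => congrFun hw ⟨i, hi⟩
  have hWker : LinearMap.ker R ≤ LinearMap.ker M.mulVecLin := by
    intro w hw
    ext t
    change ∑ i, t.1 i * w i = 0
    refine Finset.sum_eq_zero fun i _ => ?_
    by_cases hi : t.1 i = 0
    · exact mul_eq_zero_of_left hi _
    · exact mul_eq_zero_of_right _
        (hWzero w hw i (hTS (Finset.mem_biUnion.2 ⟨t.1, t.2, mem_vsupp.2 hi⟩)))
  have hsum := Submodule.finrank_sup_add_finrank_inf_eq C (LinearMap.ker R)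
  have hsup := Submodule.finrank_mono (sup_le hCker hWker)
  have hpos : 0 < Module.finrank F ↥(C ⊓ LinearMap.ker R) := by omega
  obtain ⟨v, hv, hv0⟩ := Submodule.exists_mem_ne_zero_of_ne_bot
    (Submodule.one_le_finrank_iff.1 hpos)
  have hvS : vsupp v ⊆ Sᶜ := fun i hi =>
    Finset.mem_compl.2 fun hiS => mem_vsupp.1 hi (hWzero v hv.2 i hiS)
  have hwt := Finset.card_le_card hvS
  rw [Finset.card_compl, Fintype.card_fin, hS] at hwt
  have hmin : dmin C ≤ (vsupp v).card := Nat.sInf_le ⟨v, hv.1, hv0, rfl⟩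
  omega

end Codes

/-- Theorem 7 of the paper: for an `[n,k]` code with all-symbol
locality `r` and `b = ⌈n/(r+1)⌉`, the first `b` GHWs of `B0` satisfy `d_m(B0) ≤ e_m`;
and if `ℓ` satisfies `e_ℓ < k+ℓ < e_{ℓ+1}` then `d_min(C) ≤ n + 1 - (k+ℓ)`. -/
theorem stmt15 {F : Type*} [Field F] {n k r b : ℕ} (hr : 1 ≤ r)
    (C : Submodule F (Fin n → F)) (hC : Module.finrank F C = k) (hk1 : 1 ≤ k)
    (hloc : ∀ i : Fin n, ∃ c ∈ dualCode C, (vsupp c).card ≤ r + 1 ∧ c i ≠ 0)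
    (hb : b = ⌈(n : ℚ) / (r + 1)⌉₊)
    (e : ℕ → ℤ) (heb : e b = n)
    (herec : ∀ m, 2 ≤ m → m ≤ b →
      e (m - 1) = e m - ⌈(2 * (e m : ℚ)) / (m : ℚ)⌉ + (r + 1)) :
    (∀ m, 1 ≤ m → m ≤ b → (ghw (lowWtSpan C r) m : ℤ) ≤ e m) ∧
    (∀ ℓ : ℕ, 1 ≤ ℓ → ℓ ≤ b - 1 →
      e ℓ < ((k + ℓ : ℕ) : ℤ) → ((k + ℓ : ℕ) : ℤ) < e (ℓ + 1) →
      dmin C ≤ n + 1 - (k + ℓ)) := by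
  classical
  have hs : ∀ c ∈ {c | c ∈ dualCode C ∧ (vsupp c).card ≤ r + 1}, (vsupp c).card ≤ r + 1 :=
    fun c hc => hc.2
  obtain ⟨T₀, hT₀, hcard, hli⟩ := exists_linearIndepOn_card_eq (b := b) r.succ_pos hs
    (fun i => let ⟨c, hc, hw, hci⟩ := hloc i; ⟨c, ⟨hc, hw⟩, hci⟩) (by simpa using hb)
  have main : ∀ m, 1 ≤ m → m ≤ b → ∃ T : Finset (Fin n → F),
      (T : Set (Fin n → F)) ⊆ {c | c ∈ dualCode C ∧ (vsupp c).card ≤ r + 1} ∧ T.card = m ∧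
      LinearIndepOn F id (T : Set (Fin n → F)) ∧ ((T.biUnion vsupp).card : ℤ) ≤ e m :=
    fun m hm1 hmb => exists_linearIndepOn_card_biUnion_le hs hT₀ hcard hli heb
      (by simpa using herec) hm1 hmb
  refine ⟨fun m hm1 hmb => ?_, fun ℓ hℓ1 hℓb hlt _ => ?_⟩
  · obtain ⟨T, hTs, hTc, hTli, hTe⟩ := main m hm1 hmb
    refine le_trans ?_ hTe
    have hdim : Module.finrank F (Submodule.span F (T : Set (Fin n → F))) = m := by
      rw [finrank_span_finset_eq_card hTli, hTc]
    have hsub : Submodule.span F (T : Set (Fin n → F)) ≤ lowWtSpan C r := Submodule.span_mono hTs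
    have hghw : ghw (lowWtSpan C r) m ≤
        (codeSupp (Submodule.span F (T : Set (Fin n → F)))).card :=
      Nat.sInf_le ⟨_, hsub, hdim, rfl⟩
    exact_mod_cast hghw.trans (Finset.card_le_card (codeSupp_span_subset T))
  · obtain ⟨T, hTs, hTc, hTli, hTe⟩ := main ℓ hℓ1 (by omega)
    subst hC hTc
    exact dmin_le_of_linearIndepOn_dualCode (fun c hc => (hTs hc).1) hTli (by omega)
end

section
/- Let r ≥ 1 and β be integers with 1 ≤ β ≤ r and β dividing r, let n = (r+β)(r+2)/2 and b = r+β, and let k be an integer with 1 ≤ k ≤ rn/(r+2) = n − b. Define the sequence e_1,…,e_b recursively by e_b = n and e_{m−1} = e_m − ⌈2 e_m / m⌉ + (r+1) for 2 ≤ m ≤ b, and suppose ℓ is an integer with 1 ≤ ℓ ≤ b−1 satisfying e_ℓ < k+ℓ < e_{ℓ+1}. Then for every prime power q > k·n^k there exists an [n,k] linear code C over the finite field F_q that is locally 2-reconstructible with locality r and whose minimum distance equals the upper bound of the paper's minimum-distance theorem: d_min(C) = n + 1 − (k + ℓ). -/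
open MvPolynomial in
theorem degreeOf_det_le_one {m R : Type*} [Fintype m] [DecidableEq m] [CommRing R]
    (M : Matrix m m (MvPolynomial (m × m) R))
    (hM : ∀ p i j, degreeOf p (M i j) ≤ if p = (i, j) then 1 else 0) (p : m × m) :
    degreeOf p M.det ≤ 1 := by
  rw [Matrix.det_apply']
  refine (degreeOf_sum_le _ _ _).trans (Finset.sup_le fun σ _ => ?_)
  refine (degreeOf_mul_le _ _ _).trans ?_
  have h0 : degreeOf p ((Equiv.Perm.sign σ : ℤ) : MvPolynomial (m × m) R) = 0 := by
    rw [← map_intCast (C : R →+* _), degreeOf_C]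
  rw [h0, zero_add]
  refine (degreeOf_prod_le _ _ _).trans ((Finset.sum_le_sum fun i _ => hM p (σ i) i).trans ?_)
  calc _ ≤ ∑ i, if i = p.2 then 1 else 0 := by
        refine Finset.sum_le_sum fun i _ => ?_
        by_cases h : p = (σ i, i)
        · simp [h]
        · simp [h]
    _ ≤ 1 := by simp

/-- A square matrix whose first `m` rows are arbitrary entries `x` restricted to the pattern `P`
and whose remaining rows are the unit vectors selected by `κ`. -/
def patternMatrix {R : Type*} [CommRing R] {n : ℕ} (m : ℕ) (P : Fin n → Finset (Fin n))
    (κ : {i : Fin n // m ≤ i} → Fin n) (x : Fin n × Fin n → R) : Matrix (Fin n) (Fin n) R :=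
  fun i j => if h : i.1 < m then if j ∈ P i then x (i, j) else 0
    else if κ ⟨i, not_lt.1 h⟩ = j then 1 else 0

open MvPolynomial in
theorem eval_det_patternMatrix {R : Type*} [CommRing R] {n : ℕ} (m : ℕ)
    (P : Fin n → Finset (Fin n)) (κ : {i : Fin n // m ≤ i} → Fin n) (x : Fin n × Fin n → R) :
    eval x (patternMatrix m P κ X).det = (patternMatrix m P κ x).det := by
  rw [RingHom.map_det]
  congr 1
  ext i j
  simp only [RingHom.mapMatrix_apply, Matrix.map_apply, patternMatrix]
  split_ifs <;> simp

open MvPolynomial in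
theorem det_patternMatrix_X_ne_zero {F : Type*} [Field F] {n m : ℕ}
    {P : Fin n → Finset (Fin n)} {σ : Fin n → Fin n} (hσ : Function.Injective σ)
    (hP : ∀ i : Fin n, i.1 < m → σ i ∈ P i) :
    (patternMatrix m P (fun i => σ i) (X : _ → MvPolynomial (Fin n × Fin n) F)).det ≠ 0 := by
  intro h
  have h1 := eval_det_patternMatrix (R := F) m P (fun i => σ i)
    (fun p => if σ p.1 = p.2 then 1 else 0)
  rw [h, map_zero] at h1
  have h2 : patternMatrix (R := F) m P (fun i => σ i) (fun p => if σ p.1 = p.2 then 1 else 0) =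
      (1 : Matrix (Fin n) (Fin n) F).submatrix σ id := by
    ext i j
    simp only [patternMatrix, Matrix.submatrix_apply, Matrix.one_apply, id]
    split_ifs with h3 h4 h5 h5 <;> try rfl
    exact absurd (h5 ▸ hP i h3) h4
  rw [h2] at h1
  have h3 := Matrix.det_permute (Equiv.ofBijective σ (Finite.injective_iff_bijective.1 hσ))
    (1 : Matrix (Fin n) (Fin n) F)
  rw [Equiv.coe_ofBijective, ← h1, Matrix.det_one, mul_one] at h3
  rcases Int.units_eq_one_or (Equiv.Perm.sign
    (Equiv.ofBijective σ (Finite.injective_iff_bijective.1 hσ))) with h4 | h4 <;>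
  simp [h4] at h3

open MvPolynomial in
/-- Over a large field, entries can be chosen nonzero and generic for all the pattern
matrices simultaneously. -/
theorem exists_generic_entries {F : Type*} [Field F] [Fintype F] {n m : ℕ}
    (P : Fin n → Finset (Fin n))
    (hq : n ^ Fintype.card {i : Fin n // m ≤ i} + 1 < Fintype.card F) :
    ∃ x : Fin n × Fin n → F, (∀ p, x p ≠ 0) ∧
      ∀ σ : Fin n → Fin n, Function.Injective σ → (∀ i : Fin n, i.1 < m → σ i ∈ P i) →
        (patternMatrix m P (fun i => σ i) x).det ≠ 0 := by
  classical
  let D (κ : {i : Fin n // m ≤ i} → Fin n) : MvPolynomial (Fin n × Fin n) F :=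
    (patternMatrix m P κ X).det
  let K : Finset ({i : Fin n // m ≤ i} → Fin n) := {κ | D κ ≠ 0}
  let Q : MvPolynomial (Fin n × Fin n) F := (∏ p, X p) * ∏ κ ∈ K, D κ
  have hQ : Q ≠ 0 := mul_ne_zero (Finset.prod_ne_zero_iff.2 fun p _ => X_ne_zero p)
    (Finset.prod_ne_zero_iff.2 fun κ hκ => (Finset.mem_filter.1 hκ).2)
  have hD (κ) (p) : degreeOf p (D κ) ≤ 1 := by
    refine degreeOf_det_le_one _ (fun p i j => ?_) p
    unfold patternMatrix
    split_ifs with h1 h2 h3 h4 <;> simp_all [degreeOf_X, degreeOf_zero, degreeOf_one]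
  have hdeg (p) : degreeOf p Q < Fintype.card F := by
    refine lt_of_le_of_lt (degreeOf_mul_le _ _ _) (lt_of_le_of_lt ?_ hq)
    rw [add_comm]
    refine add_le_add ((degreeOf_prod_le _ _ _).trans ?_) ((degreeOf_prod_le _ _ _).trans ?_)
    · calc _ ≤ ∑ κ ∈ K, 1 := Finset.sum_le_sum fun κ _ => hD κ p
        _ ≤ Fintype.card ({i : Fin n // m ≤ i} → Fin n) := by
            rw [Finset.sum_const, smul_eq_mul, mul_one]; exact Finset.card_le_univ K
        _ = _ := by rw [Fintype.card_fun, Fintype.card_fin]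
    · simp [degreeOf_X]
  obtain ⟨x, hx⟩ : ∃ x, eval x Q ≠ 0 := by
    by_contra! h
    exact hQ (eq_zero_of_eval_zero_at_prod_finset Q (fun _ => Finset.univ)
      (fun p => by simpa using hdeg p) fun x _ => h x)
  rw [map_mul, map_prod, map_prod, mul_ne_zero_iff, Finset.prod_ne_zero_iff,
    Finset.prod_ne_zero_iff] at hx
  refine ⟨x, fun p => by simpa using hx.1 p (Finset.mem_univ p), fun σ hσ hσP => ?_⟩
  rw [← eval_det_patternMatrix]
  exact hx.2 _ (Finset.mem_filter.2 ⟨Finset.mem_univ _, det_patternMatrix_X_ne_zero hσ hσP⟩)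


/-- The words annihilated by those rows `i` of the array `x` restricted to the pattern `P`
for which `p i` holds. -/
def kernelCode {F : Type*} [Field F] {n : ℕ} (P : Fin n → Finset (Fin n))
    (x : Fin n × Fin n → F) (p : Fin n → Prop) : Submodule F (Fin n → F) where
  carrier := {c | ∀ i, p i → ∑ j ∈ P i, x (i, j) * c j = 0}
  zero_mem' := by simp
  add_mem' := by
    intro a b ha hb i hi
    simp [mul_add, Finset.sum_add_distrib, ha i hi, hb i hi]
  smul_mem' := by
    intro t a ha i hi
    simp only [Pi.smul_apply, smul_eq_mul, mul_left_comm _ t, ← Finset.mul_sum, ha i hi, mul_zero]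

open Finset in
theorem mem_dualCode_kernelCode {F : Type*} [Field F] {n : ℕ} {P : Fin n → Finset (Fin n)}
    {x : Fin n × Fin n → F} {p : Fin n → Prop} {i : Fin n} (hi : p i) :
    (fun j => if j ∈ P i then x (i, j) else 0) ∈ dualCode (kernelCode P x p) := by
  intro c hc
  have := hc i hi
  simpa [mul_comm] using this

theorem vsupp_ite {F : Type*} [Field F] {n : ℕ} (S : Finset (Fin n)) (x : Fin n → F)
    (hx : ∀ j, x j ≠ 0) : vsupp (fun j => if j ∈ S then x j else 0) = S := by
  ext j
  simp [vsupp, hx]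

open Finset in
theorem card_filter_val_lt_of_le {n m : ℕ} (h : m ≤ n) : #{i : Fin n | i.1 < m} = m := by
  rw [Fin.card_filter_val_lt, min_eq_right h]

/-- A nonzero determinant makes the words of the code determined by the selected coordinates. -/
theorem eq_zero_of_det_patternMatrix_ne_zero {F : Type*} [Field F] {n m : ℕ}
    {P : Fin n → Finset (Fin n)} {x : Fin n × Fin n → F} {κ : {i : Fin n // m ≤ i} → Fin n}
    (hdet : (patternMatrix m P κ x).det ≠ 0) {c : Fin n → F}
    (hc : c ∈ kernelCode P x (fun i => i.1 < m)) (h0 : ∀ i, c (κ i) = 0) : c = 0 := by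
  refine Matrix.eq_zero_of_mulVec_eq_zero hdet ?_
  ext i
  simp only [Matrix.mulVec, dotProduct, patternMatrix, Pi.zero_apply]
  by_cases hi : i.1 < m
  · simpa [hi] using hc i hi
  · simpa [hi] using h0 _

open Finset in
theorem exists_mem_kernelCode_vanishing {F : Type*} [Field F] {n : ℕ} (P : Fin n → Finset (Fin n))
    (x : Fin n × Fin n → F) (I T : Finset (Fin n)) (h : #I + #T < n) :
    ∃ c ∈ kernelCode P x (· ∈ I), c ≠ 0 ∧ ∀ j ∈ T, c j = 0 := by
  let f : (Fin n → F) →ₗ[F] ((I → F) × (T → F)) :=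
    { toFun := fun c => (fun i => ∑ j ∈ P i, x (i, j) * c j, fun j => c j)
      map_add' := fun a b => by
        ext <;> simp [mul_add, Finset.sum_add_distrib]
      map_smul' := fun t a => by
        ext <;> simp [Finset.mul_sum, mul_left_comm] }
  have hf : LinearMap.ker f ≠ ⊥ := f.ker_ne_bot_of_finrank_lt (by simpa using h)
  obtain ⟨c, hc, hc0⟩ := Submodule.exists_mem_ne_zero_of_ne_bot hf
  have hc' := LinearMap.mem_ker.1 hc
  refine ⟨c, fun i hi => ?_, hc0, fun j hj => ?_⟩
  · exact congrFun (congrArg Prod.fst hc') ⟨i, hi⟩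
  · exact congrFun (congrArg Prod.snd hc') ⟨j, hj⟩

theorem finrank_kernelCode {F : Type*} [Field F] {n m : ℕ}
    {P : Fin n → Finset (Fin n)} {x : Fin n × Fin n → F} {κ : {i : Fin n // m ≤ i} → Fin n}
    (hdet : (patternMatrix m P κ x).det ≠ 0) :
    Module.finrank F (kernelCode P x (fun i => i.1 < m)) = Fintype.card {i : Fin n // m ≤ i} := by
  apply le_antisymm
  · let f : kernelCode P x (fun i => i.1 < m) →ₗ[F] ({i : Fin n // m ≤ i} → F) :=
      (LinearMap.funLeft F F κ).comp (Submodule.subtype _)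
    have hf : Function.Injective f := by
      rw [← LinearMap.ker_eq_bot, LinearMap.ker_eq_bot']
      intro c hc
      exact Subtype.ext (eq_zero_of_det_patternMatrix_ne_zero hdet c.2 fun i => congrFun hc i)
    simpa using LinearMap.finrank_le_finrank_of_injective hf
  · let f : (Fin n → F) →ₗ[F] ({i : Fin n // ¬ m ≤ i} → F) :=
      { toFun := fun c i => ∑ j ∈ P i, x (i, j) * c j
        map_add' := fun a b => by
          ext; simp [mul_add, Finset.sum_add_distrib]
        map_smul' := fun t a => by
          ext; simp [Finset.mul_sum, mul_left_comm] }
    have hker : LinearMap.ker f ≤ kernelCode P x (fun i => i.1 < m) := fun c hc i hi =>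
      congrFun (LinearMap.mem_ker.1 hc) ⟨i, not_le.2 hi⟩
    have h1 := LinearMap.finrank_range_add_finrank_ker f
    have h2 := Submodule.finrank_mono hker
    have h3 := Submodule.finrank_le (LinearMap.range f)
    have h4 := Fintype.card_subtype_compl (fun i : Fin n => m ≤ i)
    have h5 := Fintype.card_subtype_le (fun i : Fin n => m ≤ i)
    simp only [Module.finrank_fintype_fun_eq_card, Fintype.card_fin] at *
    omega

open Finset in
/-- Hall's condition for completing a set of sparse rows to a full transversal whose last `k`
entries are taken from `T`. -/
theorem exists_transversal {n b k ℓ : ℕ} (Γ : ℕ → Finset (Fin n)) (hbn : b + k ≤ n)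
    (hgrow : ∀ U ⊆ range b, #U ≤ #(U.biUnion Γ))
    (hlarge : ∀ U ⊆ range b, ℓ < #U → k + #U ≤ #(U.biUnion Γ))
    {T : Finset (Fin n)} (hT : #T = k + ℓ) :
    ∃ σ : Fin n → Fin n, Function.Injective σ ∧
      (∀ i : Fin n, i.1 < n - k → σ i ∈ if i.1 < b then Γ i else univ) ∧
      ∀ i : Fin n, n - k ≤ i.1 → σ i ∈ T := by
  let t (i : Fin n) : Finset (Fin n) :=
    if i.1 < n - k then (if i.1 < b then Γ i else univ) else T
  obtain ⟨σ, hσ, hσt⟩ := (all_card_le_biUnion_card_iff_exists_injective t).1 (by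
    intro X
    by_cases hX : ∃ i ∈ X, b ≤ i.1 ∧ i.1 < n - k
    · obtain ⟨i, hi, hi1, hi2⟩ := hX
      refine (card_le_univ X).trans (card_le_card fun j _ => mem_biUnion.2 ⟨i, hi, ?_⟩)
      simp [t, hi2, not_lt.2 hi1]
    push Not at hX
    let U : Finset ℕ := ({i ∈ X | i.1 < b}).image Fin.val
    have hU : U ⊆ range b := by
      intro u hu
      obtain ⟨i, hi, rfl⟩ := mem_image.1 hu
      exact mem_range.2 (mem_filter.1 hi).2
    have hUX : #U = #{i ∈ X | i.1 < b} := card_image_of_injective _ Fin.val_injective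
    have hΓ : U.biUnion Γ ⊆ X.biUnion t := by
      intro j hj
      obtain ⟨u, hu, hju⟩ := mem_biUnion.1 hj
      obtain ⟨i, hi, rfl⟩ := mem_image.1 hu
      obtain ⟨hiX, hib⟩ := mem_filter.1 hi
      refine mem_biUnion.2 ⟨i, hiX, ?_⟩
      simp only [t, hib, if_true]
      rwa [if_pos (by omega)]
    have hsplit := card_filter_add_card_filter_not (s := X) (fun i => i.1 < b)
    rcases (filter (fun i : Fin n => ¬ i.1 < b) X).eq_empty_or_nonempty with hY | ⟨y, hy⟩
    · rw [hY, card_empty] at hsplit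
      have := hgrow U hU
      have := card_le_card hΓ
      omega
    · have hYk : #{i ∈ X | ¬ i.1 < b} ≤ k := by
        have h1 : {i ∈ X | ¬ i.1 < b} ⊆ ({i : Fin n | i.1 < n - k} : Finset (Fin n))ᶜ := by
          intro i hi
          obtain ⟨hiX, hib⟩ := mem_filter.1 hi
          have := hX i hiX (not_lt.1 hib)
          simp only [mem_compl, mem_filter, mem_univ, true_and]
          omega
        have h2 := card_le_card h1
        rw [card_compl, card_filter_val_lt_of_le (Nat.sub_le n k), Fintype.card_fin] at h2
        omega
      obtain ⟨hyX, hyb⟩ := mem_filter.1 hy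
      have hTX : T ⊆ X.biUnion t := by
        intro j hj
        refine mem_biUnion.2 ⟨y, hyX, ?_⟩
        have := hX y hyX (not_lt.1 hyb)
        simp only [t]
        rwa [if_neg (by omega)]
      have h1 := card_le_card hTX
      have h2 := card_le_card hΓ
      rcases le_or_gt #U ℓ with h | h
      · omega
      · have := hlarge U hU h
        omega)
  refine ⟨σ, hσ, fun i hi => ?_, fun i hi => ?_⟩
  · have := hσt i
    simp only [t] at this
    rwa [if_pos hi] at this
  · have := hσt i
    simp only [t] at this
    rwa [if_neg (by omega)] at this

open Finset in
/-- A family of sparse parity supports with sufficiently large unions gives a locally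
2-reconstructible code of prescribed dimension and minimum distance. -/
theorem exists_code_of_supports {F : Type*} [Field F] [Fintype F] {n b k ℓ r : ℕ}
    (Γ : ℕ → Finset (Fin n)) (hk : 2 ≤ k) (hbn : b + k ≤ n) (hkl : k + ℓ ≤ n)
    (hcard : ∀ v < b, #(Γ v) ≤ r + 1)
    (hcov : ∀ j, ∃ v < b, j ∈ Γ v)
    (hsep : ∀ i j, i ≠ j → ∃ v < b, ¬ (i ∈ Γ v ↔ j ∈ Γ v))
    (hgrow : ∀ U ⊆ range b, #U ≤ #(U.biUnion Γ))
    (hlarge : ∀ U ⊆ range b, ℓ < #U → k + #U ≤ #(U.biUnion Γ))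
    (hsmall : ∃ U ⊆ range b, #U = ℓ ∧ #(U.biUnion Γ) < k + ℓ)
    (hq : k * n ^ k < Fintype.card F) :
    ∃ C : Submodule F (Fin n → F),
      Module.finrank F C = k ∧ Locally2Recon C r ∧ dmin C = n + 1 - (k + ℓ) := by
  have hcardk : Fintype.card {i : Fin n // n - k ≤ i} = k := by
    have h1 := card_filter_add_card_filter_not (s := univ) (fun i : Fin n => i.1 < n - k)
    rw [card_filter_val_lt_of_le (Nat.sub_le n k), card_univ, Fintype.card_fin] at h1
    simp only [not_lt] at h1
    rw [Fintype.card_subtype]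
    omega
  let P : Fin n → Finset (Fin n) := fun i => if i.1 < b then Γ i else univ
  have hqn : n ^ Fintype.card {i : Fin n // n - k ≤ i} + 1 < Fintype.card F := by
    rw [hcardk]
    have h1 : 1 ≤ n ^ k := Nat.one_le_pow _ _ (by omega)
    have h2 : 2 * n ^ k ≤ k * n ^ k := Nat.mul_le_mul_right _ hk
    omega
  obtain ⟨x, hx0, hx⟩ := exists_generic_entries P hqn
  have hdet {T : Finset (Fin n)} (hT : #T = k + ℓ) :
      ∃ κ : {i : Fin n // n - k ≤ i} → Fin n, (∀ i, κ i ∈ T) ∧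
        (patternMatrix (n - k) P κ x).det ≠ 0 := by
    obtain ⟨σ, hσ, hσP, hσT⟩ := exists_transversal Γ hbn hgrow hlarge hT
    exact ⟨fun i => σ i, fun i => hσT i i.2, hx σ hσ hσP⟩
  set C := kernelCode P x (fun i => i.1 < n - k) with hC
  have hrow (v : ℕ) (hv : v < b) : ∃ c ∈ dualCode C, vsupp c = Γ v := by
    have hvn : v < n := by omega
    refine ⟨_, mem_dualCode_kernelCode (i := ⟨v, hvn⟩) (by show v < n - k; omega), ?_⟩
    rw [vsupp_ite _ _ fun j => hx0 _]
    simp [P, hv]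
  have hsupp (c : Fin n → F) (j : Fin n) : j ∈ vsupp c ↔ c j ≠ 0 := by simp [vsupp]
  refine ⟨C, ?_, ⟨fun i => ?_, fun i j hij => ?_⟩, le_antisymm ?_ ?_⟩
  · obtain ⟨T, -, hT⟩ := exists_subset_card_eq (s := (univ : Finset (Fin n))) (n := k + ℓ)
      (by simpa using hkl)
    obtain ⟨κ, -, hκ⟩ := hdet hT
    rw [hC, finrank_kernelCode hκ, hcardk]
  · obtain ⟨v, hv, hiv⟩ := hcov i
    obtain ⟨c, hc, hcv⟩ := hrow v hv
    exact ⟨c, hc, hcv ▸ hcard v hv, (hsupp c i).1 (hcv ▸ hiv)⟩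
  · intro h
    obtain ⟨v, hv, hijv⟩ := hsep i j hij
    obtain ⟨c, hc, hcv⟩ := hrow v hv
    have h1 : c ∈ coveringParities C r i ↔ c ∈ coveringParities C r j := by rw [h]
    have h2 (a) : c ∈ coveringParities C r a ↔ a ∈ Γ v := by
      rw [← hcv, hsupp]
      exact ⟨fun h => h.2.2, fun h => ⟨hc, hcv ▸ hcard v hv, h⟩⟩
    exact hijv (by rwa [h2, h2] at h1)
  · obtain ⟨U, hU, hUl, hUΓ⟩ := hsmall
    obtain ⟨T, hΓT, -, hT⟩ := exists_subsuperset_card_eq (n := k + ℓ - 1)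
      (subset_univ (U.biUnion Γ)) (by omega) (by rw [card_univ, Fintype.card_fin]; omega)
    let I : Finset (Fin n) := {i | i.1 < n - k ∧ i.1 ∉ U}
    have hI : #I + ℓ = n - k := by
      have h1 : #{i : Fin n | i.1 < n - k ∧ i.1 ∈ U} = ℓ := by
        rw [← hUl, ← card_image_of_injective _ Fin.val_injective]
        congr 1
        ext u
        simp only [mem_image, mem_filter, mem_univ, true_and]
        constructor
        · rintro ⟨i, hi, rfl⟩
          exact hi.2
        · intro hu
          have := mem_range.1 (hU hu)
          exact ⟨⟨u, by omega⟩, ⟨by show u < n - k; omega, hu⟩, rfl⟩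
      have h2 := card_filter_add_card_filter_not (s := {i : Fin n | i.1 < n - k})
        (fun i => i.1 ∈ U)
      rw [filter_filter, filter_filter, card_filter_val_lt_of_le (Nat.sub_le n k), h1] at h2
      show #{i : Fin n | i.1 < n - k ∧ i.1 ∉ U} + ℓ = _
      omega
    obtain ⟨c, hcI, hc0, hcT⟩ := exists_mem_kernelCode_vanishing P x I T (by omega)
    have hcC : c ∈ C := by
      intro i hi
      by_cases hiU : i.1 ∈ U
      · refine sum_eq_zero fun j hj => ?_
        have hib := mem_range.1 (hU hiU)
        simp only [P, hib, if_true] at hj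
        rw [hcT j (hΓT (mem_biUnion.2 ⟨i, hiU, hj⟩)), mul_zero]
      · exact hcI i (mem_filter.2 ⟨mem_univ i, hi, hiU⟩)
    have hw : #(vsupp c) ≤ n + 1 - (k + ℓ) := by
      have h1 : vsupp c ⊆ Tᶜ := fun j hj =>
        mem_compl.2 fun hjT => (hsupp c j).1 hj (hcT j hjT)
      have h2 := card_le_card h1
      rw [card_compl, hT, Fintype.card_fin] at h2
      omega
    have hmin : dmin C ≤ #(vsupp c) := Nat.sInf_le ⟨c, hcC, hc0, rfl⟩
    exact hmin.trans hw
  · have hne : C ≠ ⊥ := by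
      intro h
      obtain ⟨T, -, hT⟩ := exists_subset_card_eq (s := (univ : Finset (Fin n))) (n := k + ℓ)
        (by simpa using hkl)
      obtain ⟨κ, -, hκ⟩ := hdet hT
      have h1 := finrank_kernelCode hκ
      rw [← hC, h, finrank_bot, hcardk] at h1
      omega
    obtain ⟨c₀, hc₀, hc₀0⟩ := Submodule.exists_mem_ne_zero_of_ne_bot hne
    have hmin : dmin C ∈ {w | ∃ v ∈ C, v ≠ 0 ∧ #(vsupp v) = w} :=
      Nat.sInf_mem ⟨_, c₀, hc₀, hc₀0, rfl⟩
    obtain ⟨c, hc, hc0, hcw⟩ := hmin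
    rw [← hcw]
    by_contra! hlt
    obtain ⟨T, hTs, hT⟩ := exists_subset_card_eq (s := (vsupp c)ᶜ) (n := k + ℓ)
      (by rw [card_compl, Fintype.card_fin]; omega)
    obtain ⟨κ, hκT, hκ⟩ := hdet hT
    refine hc0 (eq_zero_of_det_patternMatrix_ne_zero hκ hc fun i => ?_)
    have := mem_compl.1 (hTs (hκT i))
    rwa [hsupp, not_not] at this

/-- The number of edges and loops meeting an initial segment of `m` vertices in the complete
`r`-regular multipartite graph whose parts are the residue classes modulo `s`. -/
def turanCover (r s m : ℕ) : ℤ := ∑ i ∈ Finset.range m, ((r : ℤ) + 1 - i + (i / s : ℕ))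

theorem two_mul_sum_div (s : ℕ) (hs : 0 < s) (q p : ℕ) (hp : p ≤ s) :
    2 * ∑ i ∈ Finset.range (s * q + p), ((i / s : ℕ) : ℤ) = s * q * (q - 1) + 2 * q * p := by
  induction q generalizing p with
  | zero =>
    simp only [mul_zero, zero_add, Nat.cast_zero, zero_mul]
    rw [Finset.sum_eq_zero, mul_zero]
    intro i hi
    rw [Nat.div_eq_of_lt (by have := Finset.mem_range.1 hi; omega)]; simp
  | succ q ih =>
    induction p with
    | zero =>
      have := ih s le_rfl
      rw [show s * (q + 1) + 0 = s * q + s by ring, this]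
      push_cast; ring
    | succ p ihp =>
      rw [← add_assoc, Finset.sum_range_succ, mul_add, ihp (by omega),
        Nat.mul_add_div hs, Nat.div_eq_of_lt (by omega : p < s)]
      push_cast; ring

theorem two_mul_turanCover (r s m : ℕ) :
    2 * turanCover r s m = 2 * m * (r + 1) - m * (m - 1) +
      2 * ∑ i ∈ Finset.range m, ((i / s : ℕ) : ℤ) := by
  unfold turanCover
  induction m with
  | zero => simp
  | succ m ih =>
    rw [Finset.sum_range_succ, mul_add, ih, Finset.sum_range_succ]
    push_cast; ring

theorem turanCover_total (r s β : ℕ) (hs : 0 < s) (h : s * β = r + β) :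
    2 * turanCover r s (r + β) = (r + β) * (r + 2) := by
  rw [two_mul_turanCover, ← h]
  have := two_mul_sum_div s hs β 0 (by omega)
  rw [add_zero] at this
  rw [this]
  have h' : (s : ℤ) * β = r + β := by exact_mod_cast h
  push_cast
  rw [h']; ring

theorem ceil_turanCover (r s m : ℕ) (hs : 0 < s) :
    ⌈(2 * (turanCover r s (m + 1) : ℚ)) / ((m + 1 : ℕ) : ℚ)⌉ =
      2 * (r + 1) - m + (m / s : ℕ) := by
  have h1 := two_mul_turanCover r s (m + 1)
  have h2 := two_mul_sum_div s hs (m / s) (m % s + 1) (Nat.mod_lt m hs)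
  rw [← add_assoc, Nat.div_add_mod, Nat.cast_succ (m % s)] at h2
  rw [h2] at h1
  have h3 : (s : ℤ) * (m / s : ℕ) + (m % s : ℕ) = m := by exact_mod_cast Nat.div_add_mod m s
  have h4 : ((m % s : ℕ) : ℤ) + 1 ≤ s := by exact_mod_cast Nat.mod_lt m hs
  have hc : (0 : ℤ) ≤ (m / s : ℕ) := by positivity
  have hd : (0 : ℤ) ≤ (m % s : ℕ) := by positivity
  have hm : (0 : ℚ) < ((m + 1 : ℕ) : ℚ) := by positivity
  generalize ((m / s : ℕ) : ℤ) = c at *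
  generalize ((m % s : ℕ) : ℤ) = d at *
  generalize turanCover r s (m + 1) = t at *
  rw [Int.ceil_eq_iff, lt_div_iff₀ hm, div_le_iff₀ hm]
  push_cast at h1
  have hgap : 0 ≤ c * (s - (d + 1)) := mul_nonneg hc (by linarith)
  have hlo : (2 * (r + 1) - m + c - 1) * (m + 1) < 2 * t := by
    rw [h1, ← h3]; nlinarith
  have hup : 2 * t ≤ (2 * (r + 1) - m + c) * (m + 1) := by
    rw [h1, ← h3]; nlinarith
  exact ⟨by exact_mod_cast hlo, by exact_mod_cast hup⟩

theorem turanCover_increment_pos (r s β i : ℕ) (hs : 0 < s) (h : s * β = r + β)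
    (hi : i < r + β) : i ≤ r + i / s := by
  have h1 := Nat.div_add_mod i s
  have h2 := Nat.mod_lt i hs
  have h3 : i / s < β := Nat.div_lt_of_lt_mul (by omega)
  obtain ⟨t, rfl⟩ : ∃ t, s = t + 1 := ⟨s - 1, by omega⟩
  have h4 : t * (i / (t + 1)) + t ≤ t * β := by
    calc _ = t * (i / (t + 1) + 1) := by ring
      _ ≤ _ := Nat.mul_le_mul_left _ h3
  rw [add_mul] at h h1
  omega

theorem turanCover_add_le (r s β m m' : ℕ) (hs : 0 < s) (h : s * β = r + β)
    (hm : m ≤ m') (hm' : m' ≤ r + β) :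
    turanCover r s m + (m' - m : ℕ) ≤ turanCover r s m' := by
  induction m', hm using Nat.le_induction with
  | base => simp
  | succ j hj ih =>
    have := ih (by omega)
    have h5 := turanCover_increment_pos r s β j hs h (by omega)
    have h6 : turanCover r s (j + 1) = turanCover r s j + (r + 1 - j + (j / s : ℕ)) :=
      Finset.sum_range_succ _ _
    rw [h6]
    omega

open Finset in
/-- The closed star of a vertex `v` in the complete multipartite graph on `range b` whose parts
are the residue classes modulo `s`: the incident edges together with the loop at `v`. -/
def closedStar (b s v : ℕ) : Finset (Sym2 ℕ) :=
  {w ∈ range b | w = v ∨ w % s ≠ v % s}.image fun w => s(v, w)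

open Finset in
theorem mem_closedStar {b s u v w : ℕ} (hv : v < b) (h : s(v, w) ∈ closedStar b s v) :
    s(v, w) ∈ closedStar b s u ↔ u = v ∨ u = w := by
  simp only [closedStar, mem_image, mem_filter, mem_range] at h ⊢
  have hvw : w < b ∧ (w = v ∨ w % s ≠ v % s) := by
    obtain ⟨x, hx, hxe⟩ := h
    rw [Sym2.congr_right] at hxe
    exact hxe ▸ hx
  constructor
  · rintro ⟨x, -, hx⟩
    rw [Sym2.eq_iff] at hx
    omega
  · rintro (rfl | rfl)
    · exact ⟨w, hvw, rfl⟩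
    · exact ⟨v, ⟨hv, hvw.2.imp Eq.symm Ne.symm⟩, Sym2.eq_swap⟩

open Finset in
theorem card_filter_mod_eq {s : ℕ} (hs : 0 < s) (m v : ℕ) (h : ¬ v % s < m % s) :
    #{w ∈ range m | w % s = v % s} = m / s := by
  have := Nat.count_modEq_card m hs v
  rwa [if_neg h, add_zero, Nat.count_eq_card_filter_range] at this

open Finset in
theorem card_closedStar_sdiff_biUnion {r s β v : ℕ} (hs : 0 < s) (h : s * β = r + β)
    (hv : v < r + β) {U : Finset ℕ} (hU : U ⊆ range (r + β)) (hvU : v ∉ U) :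
    #(closedStar (r + β) s v \ U.biUnion (closedStar (r + β) s)) + #U =
      r + 1 + #{w ∈ U | w % s = v % s} := by
  have h1 : closedStar (r + β) s v \ U.biUnion (closedStar (r + β) s) =
      {w ∈ range (r + β) \ U | w = v ∨ w % s ≠ v % s}.image fun w => s(v, w) := by
    ext z
    constructor
    · intro hz
      rw [mem_sdiff] at hz
      obtain ⟨hz1, hz2⟩ := hz
      obtain ⟨w, hw, rfl⟩ := mem_image.1 hz1
      rw [mem_filter] at hw
      refine mem_image.2 ⟨w, mem_filter.2 ⟨mem_sdiff.2 ⟨hw.1, fun hwU => hz2 ?_⟩, hw.2⟩, rfl⟩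
      exact mem_biUnion.2 ⟨w, hwU, (mem_closedStar hv hz1).2 (Or.inr rfl)⟩
    · intro hz
      obtain ⟨w, hw, rfl⟩ := mem_image.1 hz
      rw [mem_filter, mem_sdiff] at hw
      have hz1 : s(v, w) ∈ closedStar (r + β) s v :=
        mem_image.2 ⟨w, mem_filter.2 ⟨hw.1.1, hw.2⟩, rfl⟩
      refine mem_sdiff.2 ⟨hz1, fun hz2 => ?_⟩
      obtain ⟨u, hu, hz3⟩ := mem_biUnion.1 hz2
      rcases (mem_closedStar hv hz1).1 hz3 with rfl | rfl
      · exact hvU hu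
      · exact hw.1.2 hu
  have h2 : #{w ∈ range (r + β) \ U | w = v ∨ w % s ≠ v % s} =
      1 + #{w ∈ range (r + β) \ U | w % s ≠ v % s} := by
    rw [filter_or, card_union_of_disjoint, filter_eq', if_pos, card_singleton]
    · simp [hv, hvU]
    · rw [disjoint_filter]
      rintro x - rfl
      simp
  have h3 : #{w ∈ range (r + β) | w % s = v % s} = β := by
    rw [card_filter_mod_eq hs, ← h, Nat.mul_div_cancel_left _ hs]
    rw [← h, Nat.mul_mod_right]; omega
  have h4 := card_filter_add_card_filter_not (s := range (r + β)) (fun w => w % s = v % s)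
  have h5 := card_filter_add_card_filter_not (s := U) (fun w => w % s = v % s)
  have h6 : #{w ∈ range (r + β) \ U | w % s ≠ v % s} + #{w ∈ U | w % s ≠ v % s} =
      #{w ∈ range (r + β) | w % s ≠ v % s} := by
    rw [← card_union_of_disjoint, ← filter_union, sdiff_union_of_subset hU]
    exact disjoint_filter_filter sdiff_disjoint
  rw [card_range] at h4
  rw [h1, card_image_of_injective _ (fun a b hab => Sym2.congr_right.1 hab), h2]
  simp only [ne_eq] at *
  omega

open Finset in
theorem turanCover_le_card_biUnion {r s β : ℕ} (hs : 0 < s) (h : s * β = r + β)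
    (U : Finset ℕ) (hU : U ⊆ range (r + β)) :
    turanCover r s #U ≤ #(U.biUnion (closedStar (r + β) s)) := by
  induction hm : #U generalizing U with
  | zero => simp [turanCover]
  | succ m ih =>
    obtain ⟨c, -, hc⟩ := exists_lt_card_fiber_of_mul_lt_card_of_maps_to (s := U) (t := range s)
      (f := (· % s)) (n := m / s) (fun a _ => mem_range.2 (Nat.mod_lt a hs)) (by
        rw [card_range, hm]; exact Nat.lt_succ_of_le (Nat.mul_div_le m s))
    obtain ⟨v, hv⟩ := card_pos.1 (Nat.zero_lt_of_lt hc)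
    obtain ⟨hvU, rfl⟩ := mem_filter.1 hv
    have h1 := ih (U.erase v) ((erase_subset _ _).trans hU) (by rw [card_erase_of_mem hvU, hm]; rfl)
    have h2 := card_closedStar_sdiff_biUnion hs h (mem_range.1 (hU hvU))
      ((erase_subset v U).trans hU) (notMem_erase v U)
    rw [filter_erase, card_erase_of_mem hv, card_erase_of_mem hvU, hm] at h2
    have h3 : turanCover r s (m + 1) = turanCover r s m + (r + 1 - m + (m / s : ℕ)) :=
      sum_range_succ _ _
    rw [← insert_erase hvU, biUnion_insert, union_comm, ← union_sdiff_self_eq_union,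
      card_union_of_disjoint disjoint_sdiff, h3]
    push_cast
    omega

open Finset in
theorem card_biUnion_range {r s β m : ℕ} (hs : 0 < s) (h : s * β = r + β) (hm : m ≤ r + β) :
    (#((range m).biUnion (closedStar (r + β) s)) : ℤ) = turanCover r s m := by
  induction m with
  | zero => simp [turanCover]
  | succ m ih =>
    have h2 := card_closedStar_sdiff_biUnion hs h (v := m) (by omega)
      (range_subset_range.2 (by omega : m ≤ r + β)) notMem_range_self
    rw [card_filter_mod_eq hs m m (lt_irrefl _), card_range] at h2
    have h3 : turanCover r s (m + 1) = turanCover r s m + (r + 1 - m + (m / s : ℕ)) :=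
      sum_range_succ _ _
    rw [range_add_one, biUnion_insert, union_comm, ← union_sdiff_self_eq_union,
      card_union_of_disjoint disjoint_sdiff, h3, ← ih (by omega)]
    push_cast
    omega

theorem eq_turanCover_of_recursion {r s β n : ℕ} (hs : 0 < s) (h : s * β = r + β)
    (hn : 2 * n = (r + β) * (r + 2)) {e : ℕ → ℤ} (heb : e (r + β) = n)
    (herec : ∀ m, 2 ≤ m → m ≤ r + β →
      e (m - 1) = e m - ⌈(2 * (e m : ℚ)) / (m : ℚ)⌉ + (r + 1))
    {m : ℕ} (hm1 : 1 ≤ m) (hm : m ≤ r + β) : e m = turanCover r s m := by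
  induction hm using Nat.decreasingInduction with
  | self =>
    have h1 := turanCover_total r s β hs h
    have h2 : (2 : ℤ) * n = (r + β) * (r + 2) := by exact_mod_cast hn
    rw [heb]
    linarith
  | of_succ m hm ih =>
    have h1 := herec (m + 1) (by omega) hm
    have h2 : turanCover r s (m + 1) = turanCover r s m + (r + 1 - m + (m / s : ℕ)) :=
      Finset.sum_range_succ _ _
    rw [ih (by omega), ceil_turanCover r s m hs, h2, Nat.add_sub_cancel] at h1
    linarith

open Finset in
/-- The closed stars of the complete multipartite graph, transported to `Fin n`. -/
theorem exists_supports {r s β n : ℕ} (hs : 0 < s) (h : s * β = r + β)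
    (hn : 2 * n = (r + β) * (r + 2)) :
    ∃ Γ : ℕ → Finset (Fin n), (∀ v < r + β, #(Γ v) ≤ r + 1) ∧
      (∀ j, ∃ v < r + β, j ∈ Γ v) ∧
      (∀ i j, i ≠ j → ∃ v < r + β, ¬ (i ∈ Γ v ↔ j ∈ Γ v)) ∧
      (∀ U ⊆ range (r + β), turanCover r s #U ≤ #(U.biUnion Γ)) ∧
      ∀ m ≤ r + β, (#((range m).biUnion Γ) : ℤ) = turanCover r s m := by
  let W : Finset (Sym2 ℕ) := (range (r + β)).biUnion (closedStar (r + β) s)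
  have hW : #W = n := by
    have h1 := card_biUnion_range hs h le_rfl
    have h2 := turanCover_total r s β hs h
    have h3 : (2 : ℤ) * n = (r + β) * (r + 2) := by exact_mod_cast hn
    have h4 : (#W : ℤ) = turanCover r s (r + β) := h1
    omega
  let φ : Fin n ≃ W := (finCongr hW.symm).trans W.equivFin.symm
  let Γ (v : ℕ) : Finset (Fin n) := {j | (φ j : Sym2 ℕ) ∈ closedStar (r + β) s v}
  have hΓ (v j) : j ∈ Γ v ↔ (φ j : Sym2 ℕ) ∈ closedStar (r + β) s v := by simp [Γ]
  have hcard (U : Finset ℕ) (hU : U ⊆ range (r + β)) :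
      #(U.biUnion Γ) = #(U.biUnion (closedStar (r + β) s)) := by
    refine card_bij (fun j _ => (φ j : Sym2 ℕ)) (fun j hj => ?_)
      (fun i _ j _ hij => φ.injective (Subtype.ext hij)) (fun z hz => ?_)
    · simpa only [mem_biUnion, hΓ] using hj
    · have hzW : z ∈ W := biUnion_subset_biUnion_of_subset_left _ hU hz
      refine ⟨φ.symm ⟨z, hzW⟩, ?_, by simp⟩
      simpa only [mem_biUnion, hΓ, Equiv.apply_symm_apply] using hz
  have hmem (j : Fin n) : ∃ v w, v < r + β ∧ w < r + β ∧ (φ j : Sym2 ℕ) = s(v, w) ∧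
      ∀ u, j ∈ Γ u ↔ u = v ∨ u = w := by
    obtain ⟨v, hv, hjv⟩ := mem_biUnion.1 (φ j).2
    obtain ⟨w, hw, hvw⟩ := mem_image.1 hjv
    rw [← hvw] at hjv
    refine ⟨v, w, mem_range.1 hv, mem_range.1 (mem_filter.1 hw).1, hvw.symm, fun u => ?_⟩
    rw [hΓ, ← hvw, mem_closedStar (mem_range.1 hv) hjv]
  refine ⟨Γ, fun v hv => ?_, fun j => ?_, fun i j hij => ?_, fun U hU => ?_, fun m hm => ?_⟩
  · have h1 := hcard {v} (by simpa using hv)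
    have h2 := card_closedStar_sdiff_biUnion hs h hv (empty_subset _) (notMem_empty v)
    simp only [singleton_biUnion, biUnion_empty, sdiff_empty, card_empty, filter_empty] at h1 h2
    omega
  · obtain ⟨v, w, hv, -, -, hj⟩ := hmem j
    exact ⟨v, hv, (hj v).2 (Or.inl rfl)⟩
  · obtain ⟨v, w, hv, hw, hi, hi'⟩ := hmem i
    obtain ⟨v', w', hv', hw', hj, hj'⟩ := hmem j
    by_contra! hcon
    refine hij (φ.injective (Subtype.ext ?_))
    rw [hi, hj]
    have h1 := hcon v hv
    have h2 := hcon w hw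
    have h3 := hcon v' hv'
    have h4 := hcon w' hw'
    rw [hi', hj'] at h1 h2 h3 h4
    rw [Sym2.eq_iff]
    omega
  · rw [hcard U hU]
    exact turanCover_le_card_biUnion hs h U hU
  · rw [hcard _ (range_subset_range.2 hm)]
    exact card_biUnion_range hs h hm

/-- optimal locally reconstructible codes: for `β | r`,
`n = (r+β)(r+2)/2`, `b = r+β`, any `1 ≤ k ≤ n-b`, and `ℓ` with `e_ℓ < k+ℓ < e_{ℓ+1}`,
over any finite field with more than `k·n^k` elements there exists an `[n,k]` code
that is locally 2-reconstructible with locality `r` and has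
`d_min(C) = n + 1 - (k+ℓ)`. -/
theorem stmt16 {r β n b k : ℕ} (hr : 1 ≤ r) (hβ1 : 1 ≤ β) (hβr : β ≤ r) (hdvd : β ∣ r)
    (hn : 2 * n = (r + β) * (r + 2)) (hb : b = r + β)
    (hk1 : 1 ≤ k) (hk2 : k ≤ n - b)
    (e : ℕ → ℤ) (heb : e b = n)
    (herec : ∀ m, 2 ≤ m → m ≤ b →
      e (m - 1) = e m - ⌈(2 * (e m : ℚ)) / (m : ℚ)⌉ + (r + 1))
    (ℓ : ℕ) (hl1 : 1 ≤ ℓ) (hl2 : ℓ ≤ b - 1)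
    (hle : e ℓ < ((k + ℓ : ℕ) : ℤ)) (hle2 : ((k + ℓ : ℕ) : ℤ) < e (ℓ + 1))
    (F : Type*) [Field F] [Fintype F] (hq : Fintype.card F > k * n ^ k) :
    ∃ C : Submodule F (Fin n → F),
      Module.finrank F C = k ∧
      Locally2Recon C r ∧
      dmin C = n + 1 - (k + ℓ) := by
  obtain ⟨t, ht⟩ := hdvd
  have hs : 0 < t + 1 := t.succ_pos
  have h : (t + 1) * β = r + β := by rw [ht]; ring
  subst hb
  have he {m : ℕ} (hm1 : 1 ≤ m) (hm : m ≤ r + β) : e m = turanCover r (t + 1) m :=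
    eq_turanCover_of_recursion hs h hn heb herec hm1 hm
  rw [he hl1 (by omega)] at hle
  rw [he (by omega) (by omega)] at hle2
  obtain ⟨Γ, hcard, hcov, hsep, hlow, hseg⟩ := exists_supports hs h hn
  have hmono {m m' : ℕ} (hm : m ≤ m') (hm' : m' ≤ r + β) :=
    turanCover_add_le r (t + 1) β m m' hs h hm hm'
  have hU {U : Finset ℕ} (hU : U ⊆ Finset.range (r + β)) : U.card ≤ r + β := by
    simpa using Finset.card_le_card hU
  have h0 : turanCover r (t + 1) 0 = 0 := by simp [turanCover]
  have h1 : turanCover r (t + 1) 1 = r + 1 := by simp [turanCover]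
  have htot : (n : ℤ) = turanCover r (t + 1) (r + β) := by rw [← heb, he (by omega) le_rfl]
  refine exists_code_of_supports (b := r + β) Γ ?_ (by omega) ?_ hcard hcov hsep ?_ ?_ ?_ hq
  · have := hmono hl1 (by omega)
    omega
  · have := hmono (show ℓ + 1 ≤ r + β by omega) le_rfl
    omega
  · intro U hUb
    have h2 := hmono (Nat.zero_le U.card) (hU hUb)
    have h3 := hlow U hUb
    omega
  · intro U hUb hlU
    have h2 := hmono (show ℓ + 1 ≤ U.card by omega) (hU hUb)
    have h3 := hlow U hUb
    omega
  · refine ⟨Finset.range ℓ, Finset.range_subset_range.2 (by omega), Finset.card_range ℓ, ?_⟩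
    have := hseg ℓ (by omega)
    omega
end
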